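/- Let a, b, c, d ∈ K̂ with |ad − bc|_∞ = 1 and let γ : f ↦ (af+b)/(cf+d) be the associated homography, defined on K̂ minus the point −d/c when c ≠ 0 (a set of full measure). Then the pushforward γ_*μ of the measure μ (the 1-dimensional Hausdorff measure of (K̂, d_∞), equal to the Haar measure normalized by μ(O)=1) is absolutely continuous with respect to μ, with Radon–Nikodym derivative d(γ_*μ)/dμ (ξ) = |c'ξ + d'|_∞^{−2} for μ-almost every ξ, where (a' b'; c' d') = (d −b; −c a) is a matrix representing γ⁻¹ (so that |a'd' − b'c'|_∞ = 1). -/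

import Mathlib

open MeasureTheory
open scoped ENNReal Classical

noncomputable section

namespace ArtinCoding

variable (k : Type*) [Field k] [Fintype k]

/-- The field `K̂ = k((X⁻¹))` of formal Laurent series in `X⁻¹` over `k`, realized as the
field of formal Laurent series `k((t))` in the variable `t = X⁻¹`. -/
abbrev Khat := LaurentSeries k

variable {k}

/-- The absolute value `|f|_∞ = q^{-v_∞(f)}`, where `v_∞` is the order of vanishing in the
variable `t = X⁻¹` (so a nonzero polynomial in `X` has absolute value `≥ 1`). -/
def absInf (f : Khat k) : ℝ :=
  if f = 0 then 0 else (Fintype.card k : ℝ) ^ (-f.order)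

lemma absInf_nonneg (f : Khat k) : 0 ≤ absInf f := by
  unfold absInf
  split
  · exact le_refl 0
  · positivity

lemma absInf_eq_zero {f : Khat k} : absInf f = 0 ↔ f = 0 := by
  constructor
  · intro h
    by_contra hf
    have hq : (0:ℝ) < (Fintype.card k : ℝ) := by
      have := Fintype.card_pos (α := k); positivity
    rw [absInf, if_neg hf] at h
    exact absurd h (ne_of_gt (zpow_pos hq _))
  · intro h; simp [absInf, h]

lemma absInf_neg (f : Khat k) : absInf (-f) = absInf f := by
  unfold absInf
  rw [neg_eq_zero, HahnSeries.order_neg]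

lemma absInf_add_le (f g : Khat k) : absInf (f + g) ≤ max (absInf f) (absInf g) := by
  rcases eq_or_ne (f + g) 0 with h | h
  · rw [show absInf (f+g) = 0 by rw [absInf_eq_zero]; exact h]
    exact le_max_of_le_left (absInf_nonneg f)
  rcases eq_or_ne f 0 with hf | hf
  · simp [hf]
  rcases eq_or_ne g 0 with hg | hg
  · simp [hg]
  have hmin := HahnSeries.min_order_le_order_add h
  have hq : (1:ℝ) ≤ (Fintype.card k : ℝ) := by
    exact_mod_cast Nat.one_le_iff_ne_zero.mpr Fintype.card_ne_zero
  rw [absInf, if_neg h]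
  rcases le_total f.order g.order with hod | hod
  · rw [min_eq_left hod] at hmin
    refine le_max_of_le_left ?_
    rw [absInf, if_neg hf]
    exact zpow_le_zpow_right₀ hq (neg_le_neg hmin)
  · rw [min_eq_right hod] at hmin
    refine le_max_of_le_right ?_
    rw [absInf, if_neg hg]
    exact zpow_le_zpow_right₀ hq (neg_le_neg hmin)

/-- The metric `d_∞(f,g) = |f-g|_∞` on `K̂`. -/
noncomputable instance : MetricSpace (Khat k) where
  dist f g := absInf (f - g)
  dist_self f := by simp [absInf]
  dist_comm f g := by
    have : g - f = -(f - g) := by ring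
    show absInf (f - g) = absInf (g - f)
    rw [this, absInf_neg]
  dist_triangle f g h := by
    show absInf (f - h) ≤ absInf (f - g) + absInf (g - h)
    have key : absInf (f - h) ≤ max (absInf (f - g)) (absInf (g - h)) := by
      have : f - h = (f - g) + (g - h) := by ring
      rw [this]; exact absInf_add_le _ _
    exact key.trans (max_le_add_of_nonneg (absInf_nonneg _) (absInf_nonneg _))
  eq_of_dist_eq_zero := by
    intro f g h
    have : f - g = 0 := absInf_eq_zero.mp h
    exact sub_eq_zero.mp this

/- Make sure the topology coming from the metric `d_∞` is the one used everywhere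
(the valued-field uniformity on Laurent series induces the same topology). -/
instance (priority := 10000) : UniformSpace (Khat k) := PseudoMetricSpace.toUniformSpace
instance (priority := 10000) : TopologicalSpace (Khat k) := UniformSpace.toTopologicalSpace

instance : MeasurableSpace (Khat k) := borel _
instance : BorelSpace (Khat k) := ⟨rfl⟩

variable (k)

/-- The element `X⁻¹` of `K̂` (the uniformizer `t`). -/
def Xinv : Khat k := HahnSeries.single (1 : ℤ) (1 : k)

/-- The element `X` of `K̂`. -/
def Xel : Khat k := HahnSeries.single (-1 : ℤ) (1 : k)

/-- The valuation ring `O = k[[X⁻¹]] = {f : |f|_∞ ≤ 1}`. -/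
def Oball : Set (Khat k) := {f | absInf f ≤ 1}

/-- The set `X⁻¹O`, i.e. the maximal ideal of `O`. -/
def XinvO : Set (Khat k) := (fun f => Xinv k * f) '' Oball k

/-- The ring `A = k[X]` of polynomials in `X`, viewed as a subset of `K̂`. -/
def Aset : Set (Khat k) := Set.range fun p : Polynomial k => Polynomial.aeval (Xel k) p

/-- The constants `k ⊆ K̂`. -/
def kconsts : Set (Khat k) := Set.range (algebraMap k (Khat k))

/-- The set `A∖k` of nonconstant polynomials in `X`, viewed inside `K̂`. -/
def AmK : Set (Khat k) := Aset k \ kconsts k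

/-- The field `K = k(X)` of rational functions, viewed as a subset of `K̂`
(note that `k(X) = k(X⁻¹)` as a subfield of `K̂`). -/
def Kset : Set (Khat k) := Set.range fun r : RatFunc k => (r : LaurentSeries k)

/-- The set `ᶜK = K̂ ∖ K` of irrational elements. -/
def cK : Set (Khat k) := (Kset k)ᶜ

variable {k}

/-- The integer part `[f] ∈ A = k[X]` of `f ∈ K̂`: the sum of the terms of `f` with
nonpositive exponents in `t = X⁻¹`. -/
def intPart (f : Khat k) : Khat k :=
  ∑ i ∈ Finset.Icc (min f.order 0) 0, HahnSeries.single i (f.coeff i)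

/-- The fractional part `{f} = f - [f] ∈ X⁻¹O` of `f ∈ K̂`. -/
def fracPart (f : Khat k) : Khat k := f - intPart f

/-- The Artin map `Ψ(f) = 1/f - [1/f]`. -/
def ArtinPsi (f : Khat k) : Khat k := fracPart f⁻¹

/-- The Artin continued fraction digit `a_{n+1}(f) = [1/Ψⁿ(f)]` (for `n : ℕ`, so that
`digit 0 f = a₁(f) = [1/f]`). -/
def digit (n : ℕ) (f : Khat k) : Khat k := intPart ((ArtinPsi (k := k))^[n] f)⁻¹

variable (k)

/-- The set `J = ⋃_{a ∈ A∖k} (a + X⁻¹O)`. -/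
def Jset : Set (Khat k) := ⋃ a ∈ AmK k, (fun x => a + x) '' XinvO k

/-- The domain `Ω = (J ∩ ᶜK) × (X⁻¹O ∩ ᶜK)` of the natural extension of the Artin map. -/
def OmegaSet : Set (Khat k × Khat k) := (Jset k ∩ cK k) ×ˢ (XinvO k ∩ cK k)

variable {k}

/-- The map `Φ(ξ₋, ξ₊) = (1/ξ₋ - [1/ξ₊], Ψ(ξ₊))` (as a globally defined map on `K̂ × K̂`). -/
def PhiRaw (p : Khat k × Khat k) : Khat k × Khat k :=
  (p.1⁻¹ - intPart p.2⁻¹, ArtinPsi p.2)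

/-- The coding map `Θ'` sending `(ξ₋, ξ₊)` to the bilateral sequence `(c_n)_{n ∈ ℤ}` with
`c_n = a_n(ξ₊)` for `n ≥ 1` and `c_{-n} = a_{n+1}(-1/ξ₋)` for `n ≥ 0`. -/
def ThetaRaw (p : Khat k × Khat k) : ℤ → Khat k := fun n =>
  if 1 ≤ n then digit (n - 1).toNat p.2 else digit (-n).toNat (-p.1⁻¹)

variable (k)

/-- The density `q²/|ξ₊ - ξ₋|²_∞`. -/
def dens (p : Khat k × Khat k) : ℝ≥0∞ :=
  ENNReal.ofReal ((Fintype.card k : ℝ) ^ 2 * ((absInf (p.2 - p.1)) ^ 2)⁻¹)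

/-- The measure `m̂` on `Ω` given by `dm̂(ξ₋,ξ₊) = q² dμ(ξ₋) dμ(ξ₊)/|ξ₊ - ξ₋|²_∞`. -/
def mhat (μ : Measure (Khat k)) : Measure (Khat k × Khat k) :=
  (((μ.prod μ).withDensity (dens k))).restrict (OmegaSet k)

/-- The weight `ν(a) = |a|_∞⁻² = q^{-2 deg a}` for `a ∈ A∖k` (and `0` otherwise),
with values in `ℝ≥0∞`. -/
def nuE (a : Khat k) : ℝ≥0∞ :=
  if a ∈ AmK k then ENNReal.ofReal (((absInf a) ^ 2)⁻¹) else 0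

section Homography

variable {k}

lemma one_lt_card_real : (1 : ℝ) < Fintype.card k := by
  exact_mod_cast Fintype.one_lt_card (α := k)

lemma card_zpow_pos (n : ℤ) : (0 : ℝ) < (Fintype.card k : ℝ) ^ n :=
  zpow_pos (zero_lt_one.trans one_lt_card_real) n

lemma exists_card_zpow_lt {ε : ℝ} (hε : 0 < ε) : ∃ n : ℤ, (Fintype.card k : ℝ) ^ n < ε := by
  obtain ⟨m, hm⟩ := exists_pow_lt_of_lt_one hε (inv_lt_one_of_one_lt₀ (one_lt_card_real (k := k)))
  exact ⟨-m, by simpa using hm⟩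

/-- The absolute value on `K̂` as a multiplicative map. -/
def absInfHom : Khat k →*₀ ℝ where
  toFun := absInf
  map_zero' := absInf_eq_zero.mpr rfl
  map_one' := by simp [absInf]
  map_mul' f g := by
    rcases eq_or_ne f 0 with rfl | hf
    · simp [absInf]
    rcases eq_or_ne g 0 with rfl | hg
    · simp [absInf]
    have hq := (zero_lt_one.trans (one_lt_card_real (k := k))).ne'
    simp only [absInf, if_neg hf, if_neg hg, if_neg (mul_ne_zero hf hg)]
    rw [HahnSeries.order_mul hf hg, neg_add, zpow_add₀ hq]

lemma absInf_mul (f g : Khat k) : absInf (f * g) = absInf f * absInf g :=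
  map_mul absInfHom f g

lemma absInf_div (f g : Khat k) : absInf (f / g) = absInf f / absInf g :=
  map_div₀ absInfHom f g

lemma absInf_pos {f : Khat k} (hf : f ≠ 0) : 0 < absInf f :=
  (absInf_nonneg f).lt_of_ne' fun h => hf (absInf_eq_zero.mp h)

lemma dist_eq_absInf (f g : Khat k) : dist f g = absInf (f - g) := rfl

instance : IsUltrametricDist (Khat k) where
  dist_triangle_max f g h := by
    simp only [dist_eq_absInf]
    rw [show f - h = (f - g) + (g - h) by ring]
    exact absInf_add_le _ _

lemma absInf_eq_of_absInf_sub_lt {f g : Khat k} (h : absInf (f - g) < absInf f) :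
    absInf g = absInf f := by
  apply le_antisymm
  · have := absInf_add_le f (-(f - g))
    rw [absInf_neg, max_eq_left h.le] at this
    simpa using this
  · have := absInf_add_le g (f - g)
    rw [add_sub_cancel, le_max_iff] at this
    exact this.resolve_right h.not_ge

lemma absInf_le_zpow_iff {f : Khat k} {n : ℤ} :
    absInf f ≤ (Fintype.card k : ℝ) ^ (-n) ↔ ∀ i < n, f.coeff i = 0 := by
  rcases eq_or_ne f 0 with rfl | hf
  · simpa [absInf] using (card_zpow_pos (k := k) (-n)).le
  · rw [absInf, if_neg hf, zpow_le_zpow_iff_right₀ one_lt_card_real, neg_le_neg_iff,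
      HahnSeries.le_order_iff_forall hf]

lemma mem_closedBall_zpow_iff {f g : Khat k} {n : ℤ} :
    f ∈ Metric.closedBall g ((Fintype.card k : ℝ) ^ (-n)) ↔ ∀ i < n, f.coeff i = g.coeff i := by
  simp_rw [Metric.mem_closedBall, dist_eq_absInf, absInf_le_zpow_iff, HahnSeries.coeff_sub,
    sub_eq_zero]

instance : TopologicalSpace.SeparableSpace (Khat k) := by
  refine ⟨Set.range fun f : ℤ →₀ k => ∑ i ∈ f.support, HahnSeries.single i (f i),
    Set.countable_range _, fun x => Metric.mem_closure_iff.mpr fun ε hε => ?_⟩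
  obtain ⟨m, hm⟩ := exists_card_zpow_lt (k := k) hε
  let y : ℤ →₀ k := Finsupp.onFinset (Finset.Ico x.order (-m))
    (fun i => if i < -m then x.coeff i else 0) fun i hi => by
      rw [Finset.mem_Ico]
      have h : i < -m := by
        by_contra h
        simp [h] at hi
      rw [if_pos h] at hi
      exact ⟨HahnSeries.order_le_of_coeff_ne_zero hi, h⟩
  refine ⟨_, ⟨y, rfl⟩, lt_of_le_of_lt ?_ hm⟩
  rw [← neg_neg m, ← Metric.mem_closedBall, mem_closedBall_zpow_iff]
  intro i hi
  have hy : y i = x.coeff i := by simp [y, hi]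
  simp only [HahnSeries.coeff_sum, HahnSeries.coeff_single]
  refine hy.symm.trans ((Finset.sum_eq_single i (fun j _ hj => if_neg hj.symm)
    fun h => ?_).trans (if_pos rfl)).symm
  simpa using Finsupp.notMem_support_iff.mp h

instance : SecondCountableTopology (Khat k) := UniformSpace.secondCountable_of_separable _

lemma isometry_const_add (x : Khat k) : Isometry fun y : Khat k => x + y :=
  Isometry.of_dist_eq fun y z => by simp [dist_eq_absInf]

section Measure

variable {μ : Measure (Khat k)}

lemma measure_closedBall_eq (hinv : ∀ x : Khat k, μ.map (fun y => x + y) = μ)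
    (x y : Khat k) (r : ℝ) : μ (Metric.closedBall x r) = μ (Metric.closedBall y r) := by
  conv_lhs => rw [← hinv (x - y)]
  rw [Measure.map_apply (isometry_const_add _).continuous.measurable
    Metric.isClosed_closedBall.measurableSet]
  congr 1
  ext z
  simp only [Set.mem_preimage, Metric.mem_closedBall, dist_eq_absInf]
  rw [show x - y + z - x = z - y by ring]

lemma closedBall_zpow_eq_iUnion (n : ℤ) :
    Metric.closedBall (0 : Khat k) ((Fintype.card k : ℝ) ^ (n + 1)) =
      ⋃ c : k, Metric.closedBall (HahnSeries.single (-(n + 1)) c) ((Fintype.card k : ℝ) ^ n) := by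
  ext f
  obtain ⟨m, rfl⟩ : ∃ m, n = -(m + 1) := ⟨-n - 1, by ring⟩
  rw [show -(m + 1) + 1 = -m by ring, neg_neg]
  simp only [Set.mem_iUnion, mem_closedBall_zpow_iff]
  constructor
  · refine fun h => ⟨f.coeff m, fun i hi => ?_⟩
    rcases (Int.lt_add_one_iff.mp hi).lt_or_eq with hi | rfl
    · simp [h i hi, hi.ne]
    · simp
  · rintro ⟨c, h⟩ i hi
    simp [h i (hi.trans (lt_add_one m)), hi.ne]

lemma pairwise_disjoint_closedBall_single (n : ℤ) :
    Pairwise (Function.onFun Disjoint fun c : k =>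
      Metric.closedBall (HahnSeries.single (-(n + 1)) c : Khat k) ((Fintype.card k : ℝ) ^ n)) := by
  intro c e hce
  rw [Function.onFun, Set.disjoint_left]
  obtain ⟨m, rfl⟩ : ∃ m, n = -(m + 1) := ⟨-n - 1, by ring⟩
  intro f hc he
  rw [mem_closedBall_zpow_iff] at hc he
  rw [show -(-(m + 1) + 1) = m by ring] at hc he
  have h := (hc m (lt_add_one m)).symm.trans (he m (lt_add_one m))
  exact hce (by simpa using h)

lemma measure_closedBall_zpow_add_one (hinv : ∀ x : Khat k, μ.map (fun y => x + y) = μ) (n : ℤ) :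
    μ (Metric.closedBall 0 ((Fintype.card k : ℝ) ^ (n + 1))) =
      Fintype.card k * μ (Metric.closedBall 0 ((Fintype.card k : ℝ) ^ n)) := by
  rw [closedBall_zpow_eq_iUnion, measure_iUnion (pairwise_disjoint_closedBall_single n)
    fun _ => Metric.isClosed_closedBall.measurableSet]
  simp [measure_closedBall_eq hinv _ 0, tsum_fintype]

/-- A translation-invariant measure normalized on `O` gives a ball of radius `qⁿ` mass `qⁿ`. -/
lemma measure_closedBall_zpow (hinv : ∀ x : Khat k, μ.map (fun y => x + y) = μ)
    (hO : μ (Oball k) = 1) (x : Khat k) (n : ℤ) :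
    μ (Metric.closedBall x ((Fintype.card k : ℝ) ^ n)) =
      ENNReal.ofReal ((Fintype.card k : ℝ) ^ n) := by
  rw [measure_closedBall_eq hinv x 0]
  have hq : (Fintype.card k : ℝ≥0∞) ≠ 0 := by simp
  have hq' : (Fintype.card k : ℝ) ≠ 0 := by simp
  have hstep (n : ℤ) : ENNReal.ofReal ((Fintype.card k : ℝ) ^ (n + 1)) =
      Fintype.card k * ENNReal.ofReal ((Fintype.card k : ℝ) ^ n) := by
    rw [zpow_add_one₀ hq', mul_comm, ENNReal.ofReal_mul (by positivity), ENNReal.ofReal_natCast]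
  induction n with
  | zero =>
    have h : Metric.closedBall (0 : Khat k) 1 = Oball k := by
      ext f
      simp [Oball, dist_eq_absInf]
    simp [h, hO]
  | succ n ih => rw [measure_closedBall_zpow_add_one hinv, ih, hstep]
  | pred n ih =>
    have h := measure_closedBall_zpow_add_one hinv (-(n : ℤ) - 1)
    rw [sub_add_cancel, ih, ← sub_add_cancel (-(n : ℤ)) 1, hstep, sub_add_cancel] at h
    exact ((ENNReal.mul_right_inj hq (ENNReal.natCast_ne_top _)).mp h).symm

lemma measure_singleton_eq_zero (hinv : ∀ x : Khat k, μ.map (fun y => x + y) = μ)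
    (hO : μ (Oball k) = 1) (x : Khat k) : μ {x} = 0 := by
  refine le_antisymm (ENNReal.le_of_forall_pos_le_add fun ε hε _ => ?_) zero_le
  obtain ⟨n, hn⟩ := exists_card_zpow_lt (k := k) (NNReal.coe_pos.mpr hε)
  calc μ {x} ≤ μ (Metric.closedBall x ((Fintype.card k : ℝ) ^ n)) :=
        measure_mono (Set.singleton_subset_iff.mpr
          (Metric.mem_closedBall_self (card_zpow_pos n).le))
    _ = ENNReal.ofReal ((Fintype.card k : ℝ) ^ n) := measure_closedBall_zpow hinv hO x n
    _ ≤ 0 + ε := by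
        rw [zero_add, ← ENNReal.ofReal_coe_nnreal]
        exact ENNReal.ofReal_le_ofReal hn.le

lemma isLocallyFiniteMeasure_of_translation_invariant
    (hinv : ∀ x : Khat k, μ.map (fun y => x + y) = μ) (hO : μ (Oball k) = 1) :
    IsLocallyFiniteMeasure μ where
  finiteAtNhds x := ⟨_, Metric.closedBall_mem_nhds x (card_zpow_pos 0), by
    rw [measure_closedBall_zpow hinv hO]
    exact ENNReal.ofReal_lt_top⟩

end Measure

section Balls

variable {u v : Khat k}

lemma dist_affine (u v x y : Khat k) : dist (u * x + v) (u * y + v) = absInf u * dist x y := by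
  rw [dist_eq_absInf, dist_eq_absInf, ← absInf_mul]
  ring_nf

lemma absInf_affine_eq {x y : Khat k} (h : absInf u * dist x y < absInf (u * x + v)) :
    absInf (u * y + v) = absInf (u * x + v) :=
  absInf_eq_of_absInf_sub_lt (by rwa [← dist_eq_absInf, dist_affine])

lemma continuous_affine (u v : Khat k) : Continuous fun x : Khat k => u * x + v :=
  (LipschitzWith.of_dist_le_mul (K := ⟨absInf u, absInf_nonneg u⟩)
    fun x y => (dist_affine u v x y).le).continuous

lemma continuous_absInf : Continuous (absInf : Khat k → ℝ) := by
  have h : (absInf : Khat k → ℝ) = fun x => dist x 0 := by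
    ext x
    simp [dist_eq_absInf]
  rw [h]
  exact continuous_id.dist continuous_const

lemma exists_card_zpow_lt_affine {x : Khat k} (hx : u * x + v ≠ 0) {ε : ℝ} (hε : 0 < ε) :
    ∃ n : ℤ, (Fintype.card k : ℝ) ^ n < ε ∧
      absInf u * (Fintype.card k : ℝ) ^ n < absInf (u * x + v) := by
  have hu : 0 < absInf u + 1 := by linarith [absInf_nonneg u]
  obtain ⟨n, hn⟩ := exists_card_zpow_lt (k := k) (lt_min hε (div_pos (absInf_pos hx) hu))
  rw [lt_min_iff, lt_div_iff₀ hu] at hn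
  exact ⟨n, hn.1, by linarith [card_zpow_pos (k := k) n]⟩

/-- The balls on which `|u x + v|` is constant by the ultrametric inequality, together with
the zeros of `u x + v`. -/
def affineCells (u v : Khat k) : Set (Set (Khat k)) :=
  {s | ∃ (x : Khat k) (n : ℤ), absInf u * (Fintype.card k : ℝ) ^ n < absInf (u * x + v) ∧
    s = Metric.closedBall x ((Fintype.card k : ℝ) ^ n)} ∪
  {s | ∃ x : Khat k, u * x + v = 0 ∧ s = {x}}

lemma measurableSet_of_mem_affineCells {s : Set (Khat k)} (hs : s ∈ affineCells u v) :
    MeasurableSet s := by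
  rcases hs with ⟨x, n, -, rfl⟩ | ⟨x, -, rfl⟩
  · exact Metric.isClosed_closedBall.measurableSet
  · exact measurableSet_singleton x

lemma isPiSystem_affineCells (u v : Khat k) : IsPiSystem (affineCells u v) := by
  intro s hs t ht hst
  have hsub : s ⊆ t ∨ t ⊆ s := by
    rcases hs with ⟨x, n, -, rfl⟩ | ⟨x, -, rfl⟩
    · rcases ht with ⟨y, m, -, rfl⟩ | ⟨y, -, rfl⟩
      · rcases IsUltrametricDist.closedBall_subset_trichotomy x y ((Fintype.card k : ℝ) ^ n)
          ((Fintype.card k : ℝ) ^ m) with h | h | h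
        · exact Or.inl h
        · exact Or.inr h
        · exact absurd hst (Set.not_nonempty_iff_eq_empty.mpr h.inter_eq)
      · exact Or.inr (Set.singleton_subset_iff.mpr (Set.inter_singleton_nonempty.mp hst))
    · exact Or.inl (Set.singleton_subset_iff.mpr (Set.singleton_inter_nonempty.mp hst))
  rcases hsub with h | h
  · rwa [Set.inter_eq_left.mpr h]
  · rwa [Set.inter_eq_right.mpr h]

lemma exists_countable_affineCells_sUnion_eq (huv : u ≠ 0 ∨ v ≠ 0) {U : Set (Khat k)}
    (hU : IsOpen U) : ∃ T ⊆ affineCells u v, T.Countable ∧ ⋃₀ T = U := by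
  have hball (x : {x : Khat k // x ∈ U ∧ u * x + v ≠ 0}) : ∃ n : ℤ,
      Metric.closedBall x.1 ((Fintype.card k : ℝ) ^ n) ⊆ U ∧
      absInf u * (Fintype.card k : ℝ) ^ n < absInf (u * x.1 + v) := by
    obtain ⟨ε, hε, hεU⟩ := Metric.isOpen_iff.mp hU x x.2.1
    obtain ⟨n, hn, hn'⟩ := exists_card_zpow_lt_affine x.2.2 hε
    exact ⟨n, (Metric.closedBall_subset_ball hn).trans hεU, hn'⟩
  choose n hnU hn using hball
  obtain ⟨I, hI, hIU⟩ := TopologicalSpace.isOpen_iUnion_countable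
    (fun x => Metric.closedBall x.1 ((Fintype.card k : ℝ) ^ n x))
    fun x => IsUltrametricDist.isOpen_closedBall _ (card_zpow_pos _).ne'
  have hzero : {x : Khat k | x ∈ U ∧ u * x + v = 0}.Subsingleton := by
    rintro x ⟨-, hx⟩ y ⟨-, hy⟩
    have hu : u ≠ 0 := by
      rintro rfl
      simp_all
    exact mul_left_cancel₀ hu (add_right_cancel (hx.trans hy.symm))
  refine ⟨(fun x => Metric.closedBall x.1 ((Fintype.card k : ℝ) ^ n x)) '' I ∪
    (fun x => {x}) '' {x : Khat k | x ∈ U ∧ u * x + v = 0}, ?_,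
    (hI.image _).union (hzero.countable.image _), ?_⟩
  · rintro s (⟨x, -, rfl⟩ | ⟨x, hx, rfl⟩)
    · exact Or.inl ⟨x, n x, hn x, rfl⟩
    · exact Or.inr ⟨x, hx.2, rfl⟩
  · rw [Set.sUnion_union, Set.sUnion_image, Set.sUnion_image, hIU, Set.biUnion_of_singleton]
    ext x
    constructor
    · rintro (h | h)
      · obtain ⟨y, hy⟩ := Set.mem_iUnion.mp h
        exact hnU y hy
      · exact h.1
    · intro hx
      by_cases h : u * x + v = 0
      · exact Or.inr ⟨hx, h⟩
      · exact Or.inl (Set.mem_iUnion.mpr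
          ⟨⟨x, hx, h⟩, Metric.mem_closedBall_self (card_zpow_pos _).le⟩)

lemma borel_eq_generateFrom_affineCells (huv : u ≠ 0 ∨ v ≠ 0) :
    borel (Khat k) = MeasurableSpace.generateFrom (affineCells u v) := by
  apply le_antisymm
  · refine MeasurableSpace.generateFrom_le fun U hU => ?_
    obtain ⟨T, hT, hTc, rfl⟩ := exists_countable_affineCells_sUnion_eq huv hU
    exact MeasurableSet.sUnion hTc fun s hs => MeasurableSpace.measurableSet_generateFrom (hT hs)
  · exact MeasurableSpace.generateFrom_le fun s hs => measurableSet_of_mem_affineCells hs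

lemma measure_ext_affineCells (huv : u ≠ 0 ∨ v ≠ 0) {ν ρ : Measure (Khat k)}
    (hfin : ∀ s ∈ affineCells u v, ν s ≠ ∞) (h : ∀ s ∈ affineCells u v, ν s = ρ s) : ν = ρ := by
  obtain ⟨T, hT, hTc, hTU⟩ := exists_countable_affineCells_sUnion_eq huv isOpen_univ
  refine Measure.ext_of_generateFrom_of_cover (borel_eq_generateFrom_affineCells huv) hTc
    (isPiSystem_affineCells u v) hTU (fun t ht => hfin t (hT ht)) (fun t ht s hs => ?_)
    fun t ht => h t (hT ht)
  rcases (s ∩ t).eq_empty_or_nonempty with he | hne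
  · simp [he]
  · exact h _ (isPiSystem_affineCells u v s hs t (hT ht) hne)

end Balls

section Field

variable {F : Type*} [Field F] {a b c d x : F}

lemma denominator_homography (hx : c * x + d ≠ 0) :
    -c * ((a * x + b) / (c * x + d)) + a = (a * d - b * c) / (c * x + d) := by
  rw [← mul_div_assoc, div_add' _ _ _ hx]
  congr 1
  ring

lemma homography_inverse (hdet : a * d - b * c ≠ 0) (hx : c * x + d ≠ 0) :
    (d * ((a * x + b) / (c * x + d)) + -b) / (-c * ((a * x + b) / (c * x + d)) + a) = x := by
  rw [denominator_homography hx, div_eq_iff (div_ne_zero hdet hx), ← mul_div_assoc,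
    ← mul_div_assoc, div_add' _ _ _ hx]
  congr 1
  ring

end Field

section Map

variable {a b c d : Khat k}

lemma dist_homography (hdet : absInf (a * d - b * c) = 1) {x y : Khat k}
    (hx : c * x + d ≠ 0) (h : absInf c * dist x y < absInf (c * x + d)) :
    c * y + d ≠ 0 ∧ dist ((a * x + b) / (c * x + d)) ((a * y + b) / (c * y + d)) =
      dist x y / absInf (c * x + d) ^ 2 := by
  have he := absInf_affine_eq h
  have hy : c * y + d ≠ 0 := fun h0 =>
    (absInf_pos hx).ne' (he.symm.trans (absInf_eq_zero.mpr h0))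
  refine ⟨hy, ?_⟩
  have key : (a * x + b) / (c * x + d) - (a * y + b) / (c * y + d) =
      (a * d - b * c) * (x - y) / ((c * x + d) * (c * y + d)) := by
    rw [div_sub_div _ _ hx hy]
    ring
  rw [dist_eq_absInf, key, absInf_div, absInf_mul, absInf_mul, hdet, he, one_mul, ← sq,
    dist_eq_absInf]

lemma continuousAt_homography (hdet : absInf (a * d - b * c) = 1) {x : Khat k}
    (hx : c * x + d ≠ 0) : ContinuousAt (fun f => (a * f + b) / (c * f + d)) x := by
  rw [Metric.continuousAt_iff]
  intro ε hε
  have hpos := absInf_pos hx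
  obtain ⟨n, hn, hn'⟩ := exists_card_zpow_lt_affine hx (mul_pos hε (pow_pos hpos 2))
  refine ⟨_, card_zpow_pos (k := k) n, fun {y} hy => ?_⟩
  rw [dist_comm] at hy ⊢
  rw [(dist_homography hdet hx (lt_of_le_of_lt
    (mul_le_mul_of_nonneg_left hy.le (absInf_nonneg c)) hn')).2, div_lt_iff₀ (pow_pos hpos 2)]
  exact hy.trans hn

lemma measurable_homography (hdet : absInf (a * d - b * c) = 1) :
    Measurable fun f : Khat k => (a * f + b) / (c * f + d) := by
  refine measurable_of_continuousOn_compl_singleton (-d / c) fun x hx =>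
    (continuousAt_homography hdet fun h => ?_).continuousWithinAt
  rcases eq_or_ne c 0 with rfl | hc
  · have hd : d = 0 := by simpa using h
    simp [hd, absInf] at hdet
  · exact hx (by rw [Set.mem_singleton_iff, eq_div_iff hc]; linear_combination h)

/-- Away from the pole, the preimage of a small ball under a homography is a ball. -/
lemma preimage_homography_closedBall (hdet : absInf (a * d - b * c) = 1) {x : Khat k} {r : ℝ}
    (hr : 0 ≤ r) (h : absInf (-c) * r < absInf (-c * x + a)) :
    (fun f => (a * f + b) / (c * f + d)) ⁻¹' Metric.closedBall x r \ {f | c * f + d = 0} =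
      Metric.closedBall ((d * x + -b) / (-c * x + a)) (r / absInf (-c * x + a) ^ 2) := by
  have hdet0 : a * d - b * c ≠ 0 := fun h0 => by simp [h0, absInf] at hdet
  have hdet' : absInf (d * a - -b * -c) = 1 := by rw [← hdet]; ring_nf
  have hpos : 0 < absInf (-c * x + a) :=
    (mul_nonneg (absInf_nonneg _) hr).trans_lt h
  have hx : -c * x + a ≠ 0 := fun h0 => hpos.ne' (absInf_eq_zero.mpr h0)
  have hden : c * ((d * x + -b) / (-c * x + a)) + d = (a * d - b * c) / (-c * x + a) := by
    rw [← mul_div_assoc, div_add' _ _ _ hx]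
    congr 1
    ring
  have hden0 : c * ((d * x + -b) / (-c * x + a)) + d ≠ 0 := hden ▸ div_ne_zero hdet0 hx
  have hinv : (a * ((d * x + -b) / (-c * x + a)) + b) /
      (c * ((d * x + -b) / (-c * x + a)) + d) = x := by
    rw [hden, div_eq_iff (div_ne_zero hdet0 hx), ← mul_div_assoc, ← mul_div_assoc,
      div_add' _ _ _ hx]
    congr 1
    ring
  have habs : absInf (c * ((d * x + -b) / (-c * x + a)) + d) = (absInf (-c * x + a))⁻¹ := by
    rw [hden, absInf_div, hdet, one_div]
  have hc : absInf c = absInf (-c) := (absInf_neg c).symm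
  ext f
  simp only [Set.mem_sdiff, Set.mem_preimage, Set.mem_ofPred_eq, Metric.mem_closedBall]
  constructor
  · rintro ⟨hf, hf0⟩
    rw [dist_comm] at hf
    have := (dist_homography hdet' hx
      ((mul_le_mul_of_nonneg_left hf (absInf_nonneg _)).trans_lt h)).2
    rw [homography_inverse hdet0 hf0, dist_comm] at this
    rw [this]
    gcongr
  · intro hf
    rw [dist_comm] at hf
    obtain ⟨hf0, hdist⟩ := dist_homography (y := f) hdet hden0 (by
      refine (mul_le_mul_of_nonneg_left hf (absInf_nonneg _)).trans_lt ?_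
      rw [habs, hc, ← mul_div_assoc, div_lt_iff₀ (pow_pos hpos 2), sq,
        inv_mul_cancel_left₀ hpos.ne']
      exact h)
    refine ⟨?_, hf0⟩
    rw [hinv, habs, dist_comm] at hdist
    rw [hdist, inv_pow, div_inv_eq_mul]
    exact (le_div_iff₀ (pow_pos hpos 2)).mp hf

lemma subsingleton_pole (hdet : absInf (a * d - b * c) = 1) :
    {f : Khat k | c * f + d = 0}.Subsingleton := by
  intro x hx y hy
  have hc : c ≠ 0 := by
    rintro rfl
    have hd : d = 0 := by simpa using hx
    simp [hd, absInf] at hdet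
  exact mul_left_cancel₀ hc (add_right_cancel (Eq.trans hx (Eq.symm hy)))

lemma homography_preimage_zero_denominator_subset (hdet : absInf (a * d - b * c) = 1)
    {x : Khat k} (hx : -c * x + a = 0) :
    (fun f => (a * f + b) / (c * f + d)) ⁻¹' {x} ⊆ {f | c * f + d = 0} := by
  rintro f rfl
  by_contra hf
  rw [denominator_homography hf, div_eq_zero_iff] at hx
  rcases hx with h | h
  · simp [h, absInf] at hdet
  · exact hf h

lemma exists_absInf_eq_zpow {f : Khat k} (hf : f ≠ 0) :
    ∃ m : ℤ, absInf f = (Fintype.card k : ℝ) ^ m :=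
  ⟨-f.order, if_neg hf⟩

lemma map_homography_eq_withDensity {μ : Measure (Khat k)}
    (hinv : ∀ x : Khat k, μ.map (fun y => x + y) = μ) (hO : μ (Oball k) = 1)
    (hdet : absInf (a * d - b * c) = 1) :
    μ.map (fun f => (a * f + b) / (c * f + d)) =
      μ.withDensity fun ξ => ENNReal.ofReal ((absInf (-c * ξ + a) ^ 2)⁻¹) := by
  have hpole : μ {f | c * f + d = 0} = 0 := by
    rcases (subsingleton_pole hdet).eq_empty_or_singleton with h | ⟨x, h⟩ <;> rw [h]
    · exact measure_empty
    · exact measure_singleton_eq_zero hinv hO x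
  have hca : -c ≠ 0 ∨ a ≠ 0 := by
    by_contra! h
    simp [neg_eq_zero.mp h.1, h.2, absInf] at hdet
  have hball {x : Khat k} {n : ℤ}
      (h : absInf (-c) * (Fintype.card k : ℝ) ^ n < absInf (-c * x + a)) :
      μ.map (fun f => (a * f + b) / (c * f + d))
        (Metric.closedBall x ((Fintype.card k : ℝ) ^ n)) =
      ENNReal.ofReal ((Fintype.card k : ℝ) ^ n / absInf (-c * x + a) ^ 2) := by
    have hx : -c * x + a ≠ 0 := fun h0 => h.not_ge <| by
      rw [absInf_eq_zero.mpr h0]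
      exact mul_nonneg (absInf_nonneg _) (card_zpow_pos n).le
    obtain ⟨m, hm⟩ := exists_absInf_eq_zpow hx
    have hpow : (Fintype.card k : ℝ) ^ n / absInf (-c * x + a) ^ 2 =
        (Fintype.card k : ℝ) ^ (n - m * 2) := by
      rw [hm, zpow_sub₀ (by simp), zpow_mul, zpow_ofNat]
    rw [Measure.map_apply (measurable_homography hdet) Metric.isClosed_closedBall.measurableSet,
      ← measure_sdiff_null hpole, preimage_homography_closedBall hdet (card_zpow_pos n).le h, hpow,
      measure_closedBall_zpow hinv hO]
  refine measure_ext_affineCells hca ?_ ?_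
  · rintro s (⟨x, n, h, rfl⟩ | ⟨x, hx, rfl⟩)
    · rw [hball h]
      exact ENNReal.ofReal_ne_top
    · rw [Measure.map_apply (measurable_homography hdet) (measurableSet_singleton x),
        measure_mono_null (homography_preimage_zero_denominator_subset hdet hx) hpole]
      exact ENNReal.zero_ne_top
  · rintro s (⟨x, n, h, rfl⟩ | ⟨x, hx, rfl⟩)
    · have hmeas : MeasurableSet (Metric.closedBall x ((Fintype.card k : ℝ) ^ n)) :=
        Metric.isClosed_closedBall.measurableSet
      have hconst : Set.EqOn (fun ξ => ENNReal.ofReal ((absInf (-c * ξ + a) ^ 2)⁻¹))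
          (fun _ => ENNReal.ofReal ((absInf (-c * x + a) ^ 2)⁻¹))
          (Metric.closedBall x ((Fintype.card k : ℝ) ^ n)) := fun y hy => by
        dsimp only
        rw [absInf_affine_eq (x := x) (y := y)]
        rw [dist_comm]
        exact (mul_le_mul_of_nonneg_left hy (absInf_nonneg _)).trans_lt h
      rw [hball h, withDensity_apply _ hmeas, setLIntegral_congr_fun hmeas hconst,
        setLIntegral_const, measure_closedBall_zpow hinv hO, ← ENNReal.ofReal_mul (by positivity),
        div_eq_inv_mul]
    · rw [Measure.map_apply (measurable_homography hdet) (measurableSet_singleton x),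
        measure_mono_null (homography_preimage_zero_denominator_subset hdet hx) hpole]
      exact (withDensity_absolutelyContinuous μ _ (measure_singleton_eq_zero hinv hO x)).symm

end Map

end Homography

/-- The pushforward of the Haar measure `μ` under a homography `γ` of
determinant of absolute value `1` is absolutely continuous with respect to `μ`, with
Radon–Nikodym derivative `ξ ↦ |c'ξ + d'|⁻²` where `(c', d') = (-c, a)` comes from a matrix
representing `γ⁻¹`. -/
theorem statement_5 (k : Type*) [Field k] [Fintype k] (μ : MeasureTheory.Measure (Khat k))
    (hinv : ∀ x : Khat k, MeasureTheory.Measure.map (fun y => x + y) μ = μ)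
    (hO : μ (Oball k) = 1)
    (a b c d : Khat k) (hdet : absInf (a * d - b * c) = 1) :
    MeasureTheory.Measure.map (fun f => (a * f + b) / (c * f + d)) μ ≪ μ ∧
    ∀ᵐ ξ ∂μ,
      (MeasureTheory.Measure.map (fun f => (a * f + b) / (c * f + d)) μ).rnDeriv μ ξ
        = ENNReal.ofReal (((absInf (-c * ξ + a)) ^ 2)⁻¹) := by
  have := isLocallyFiniteMeasure_of_translation_invariant hinv hO
  rw [map_homography_eq_withDensity hinv hO hdet]
  exact ⟨withDensity_absolutelyContinuous _ _, Measure.rnDeriv_withDensity μ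
    (((continuous_absInf.comp (continuous_affine (-c) a)).measurable.pow_const 2).inv.ennreal_ofReal)⟩

end ArtinCoding
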